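/- Let s ∈ (0,1), m ≥ 1, and let g: ℝ^N\{0} → ℝ be nonnegative, radially non-increasing, symmetric, and integrable on ℝ^N. There exist constants c₀ > 0 and r₀ > 0 depending only on N, s, g (not on m) such that: if E is a minimizer of ℰ_{s,g} = P_s + V_g among sets of volume m and x ∈ ℝ^N satisfies |E ∩ B_r(x)| > 0 for all r > 0, then |E ∩ B_r(x)| ≥ c₀ r^N for all r ∈ (0, r₀]. -/

import Mathlib

open MeasureTheory ENNReal Set

noncomputable def fracKer (N : ℕ) (s : ℝ) (x : EuclideanSpace ℝ (Fin N)) : ℝ≥0∞ :=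
  ENNReal.ofReal (‖x‖ ^ (-((N : ℝ) + s)))

noncomputable def fracPer (N : ℕ) (s : ℝ) (E : Set (EuclideanSpace ℝ (Fin N))) : ℝ≥0∞ :=
  ∫⁻ x in E, ∫⁻ y in Eᶜ, fracKer N s (x - y)

noncomputable def rieszPot (N : ℕ) (g : EuclideanSpace ℝ (Fin N) → ℝ)
    (E : Set (EuclideanSpace ℝ (Fin N))) : ℝ≥0∞ :=
  ∫⁻ x in E, ∫⁻ y in E, ENNReal.ofReal (g (x - y))

open Metric

section

variable {N : ℕ} {s : ℝ}

/-- The fractional interaction energy of two sets. -/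
noncomputable def fracInter (N : ℕ) (s : ℝ) (A B : Set (EuclideanSpace ℝ (Fin N))) : ℝ≥0∞ :=
  ∫⁻ x in A, ∫⁻ y in B, fracKer N s (x - y)

lemma measurable_fracKer (N : ℕ) (s : ℝ) : Measurable (fracKer N s) := by
  unfold fracKer
  fun_prop

lemma fracKer_neg (x : EuclideanSpace ℝ (Fin N)) : fracKer N s (-x) = fracKer N s x := by
  simp [fracKer]

lemma measurable_lintegral_fracKer (B : Set (EuclideanSpace ℝ (Fin N))) :
    Measurable fun x => ∫⁻ y in B, fracKer N s (x - y) := by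
  have h : Measurable fun p : EuclideanSpace ℝ (Fin N) × EuclideanSpace ℝ (Fin N) =>
      fracKer N s (p.1 - p.2) := (measurable_fracKer N s).comp (by fun_prop)
  exact h.lintegral_prod_right'

lemma fracPer_eq_fracInter (E : Set (EuclideanSpace ℝ (Fin N))) :
    fracPer N s E = fracInter N s E Eᶜ := rfl

lemma fracInter_comm (A B : Set (EuclideanSpace ℝ (Fin N))) :
    fracInter N s A B = fracInter N s B A := by
  have h : Measurable fun p : EuclideanSpace ℝ (Fin N) × EuclideanSpace ℝ (Fin N) =>
      fracKer N s (p.1 - p.2) := (measurable_fracKer N s).comp (by fun_prop)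
  unfold fracInter
  rw [lintegral_lintegral_swap h.aemeasurable]
  refine lintegral_congr fun y => lintegral_congr fun x => ?_
  rw [← fracKer_neg, neg_sub]

lemma fracInter_union_left {A A' : Set (EuclideanSpace ℝ (Fin N))}
    (B : Set (EuclideanSpace ℝ (Fin N))) (hA' : MeasurableSet A') (h : Disjoint A A') :
    fracInter N s (A ∪ A') B = fracInter N s A B + fracInter N s A' B :=
  lintegral_union hA' h

lemma fracInter_union_right (A : Set (EuclideanSpace ℝ (Fin N)))
    {B B' : Set (EuclideanSpace ℝ (Fin N))} (hB' : MeasurableSet B') (h : Disjoint B B') :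
    fracInter N s A (B ∪ B') = fracInter N s A B + fracInter N s A B' := by
  unfold fracInter
  rw [← lintegral_add_left (measurable_lintegral_fracKer B)]
  exact lintegral_congr fun x => lintegral_union hB' h

lemma fracInter_mono {A A' B B' : Set (EuclideanSpace ℝ (Fin N))} (hA : A ⊆ A') (hB : B ⊆ B') :
    fracInter N s A B ≤ fracInter N s A' B' :=
  (lintegral_mono_set hA).trans (lintegral_mono fun _ => lintegral_mono_set hB)

lemma rieszPot_mono (g : EuclideanSpace ℝ (Fin N) → ℝ) {E F : Set (EuclideanSpace ℝ (Fin N))}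
    (h : E ⊆ F) : rieszPot N g E ≤ rieszPot N g F :=
  (lintegral_mono_set h).trans (lintegral_mono fun _ => lintegral_mono_set h)

lemma rieszPot_le (g : EuclideanSpace ℝ (Fin N) → ℝ) (E : Set (EuclideanSpace ℝ (Fin N))) :
    rieszPot N g E ≤ (∫⁻ z, ENNReal.ofReal (g z)) * volume E := by
  unfold rieszPot
  rw [← setLIntegral_const]
  refine lintegral_mono fun x => (setLIntegral_le_lintegral _ _).trans_eq ?_
  exact lintegral_sub_left_eq_self (fun z => ENNReal.ofReal (g z)) x

lemma lintegral_comp_smul_of_pos {c : ℝ} (hc : 0 < c)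
    (f : EuclideanSpace ℝ (Fin N) → ℝ≥0∞) :
    ∫⁻ x, f (c • x) = ENNReal.ofReal (c⁻¹ ^ N) * ∫⁻ x, f x := by
  have h := lintegral_map_equiv (μ := volume) f
    (MeasurableEquiv.smul₀ (α := EuclideanSpace ℝ (Fin N)) c hc.ne')
  rw [MeasurableEquiv.coe_smul₀, Measure.map_addHaar_smul _ hc.ne', lintegral_smul_measure] at h
  rw [← h, finrank_euclideanSpace_fin, abs_of_pos (by positivity), inv_pow, smul_eq_mul]

lemma setLIntegral_preimage_smul {c : ℝ} (hc : 0 < c) {A : Set (EuclideanSpace ℝ (Fin N))}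
    (hA : MeasurableSet A) (f : EuclideanSpace ℝ (Fin N) → ℝ≥0∞) :
    ∫⁻ x in (c • ·) ⁻¹' A, f (c • x) = ENNReal.ofReal (c⁻¹ ^ N) * ∫⁻ x in A, f x := by
  rw [← lintegral_indicator hA, ← lintegral_comp_smul_of_pos hc,
    ← lintegral_indicator (hA.preimage (measurable_const_smul c))]
  rfl

lemma volume_preimage_smul {c : ℝ} (hc : 0 < c) {A : Set (EuclideanSpace ℝ (Fin N))}
    (hA : MeasurableSet A) :
    volume ((c • ·) ⁻¹' A) = ENNReal.ofReal (c⁻¹ ^ N) * volume A := by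
  simpa using setLIntegral_preimage_smul hc hA 1

lemma lintegral_lintegral_preimage_smul_le {c : ℝ} (hc : 0 < c)
    {A B : Set (EuclideanSpace ℝ (Fin N))} (hA : MeasurableSet A) (hB : MeasurableSet B)
    {k : EuclideanSpace ℝ (Fin N) → ℝ≥0∞} {q : ℝ≥0∞} (hq : q ≠ ∞)
    (hk : ∀ z, k z ≤ q * k (c • z)) :
    ∫⁻ x in (c • ·) ⁻¹' A, ∫⁻ y in (c • ·) ⁻¹' B, k (x - y) ≤
      q * ENNReal.ofReal (c⁻¹ ^ N) ^ 2 * ∫⁻ x in A, ∫⁻ y in B, k (x - y) := by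
  calc ∫⁻ x in (c • ·) ⁻¹' A, ∫⁻ y in (c • ·) ⁻¹' B, k (x - y)
      ≤ ∫⁻ x in (c • ·) ⁻¹' A, ∫⁻ y in (c • ·) ⁻¹' B, q * k (c • x - c • y) := by
        refine lintegral_mono fun x => lintegral_mono fun y => ?_
        simpa [smul_sub] using hk (x - y)
    _ = ∫⁻ x in (c • ·) ⁻¹' A,
          q * (ENNReal.ofReal (c⁻¹ ^ N) * ∫⁻ y in B, k (c • x - y)) := by
        refine lintegral_congr fun x => ?_
        rw [lintegral_const_mul' _ _ hq,
          setLIntegral_preimage_smul hc hB fun y => k (c • x - y)]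
    _ = q * ENNReal.ofReal (c⁻¹ ^ N) ^ 2 * ∫⁻ x in A, ∫⁻ y in B, k (x - y) := by
        rw [lintegral_const_mul' _ _ hq, lintegral_const_mul' _ _ ofReal_ne_top,
          setLIntegral_preimage_smul hc hA fun x => ∫⁻ y in B, k (x - y)]
        ring

lemma fracKer_smul {c : ℝ} (hc : 0 < c) (z : EuclideanSpace ℝ (Fin N)) :
    fracKer N s (c • z) = ENNReal.ofReal (c ^ (-((N : ℝ) + s))) * fracKer N s z := by
  unfold fracKer
  rw [← ENNReal.ofReal_mul (by positivity), norm_smul, Real.norm_of_nonneg hc.le,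
    Real.mul_rpow hc.le (norm_nonneg _)]

lemma fracKer_le_mul_smul (hs : 0 < s) {c : ℝ} (hc : 0 < c) (hc1 : c ≤ 1)
    (z : EuclideanSpace ℝ (Fin N)) :
    fracKer N s z ≤ ENNReal.ofReal (c ^ N) * fracKer N s (c • z) := by
  rw [fracKer_smul hc, ← mul_assoc, ← ENNReal.ofReal_mul (by positivity), ← Real.rpow_natCast,
    ← Real.rpow_add hc]
  refine le_mul_of_one_le_left' ?_
  rw [ENNReal.one_le_ofReal]
  exact Real.one_le_rpow_of_pos_of_le_one_of_nonpos hc hc1 (by linarith)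

lemma fracPer_preimage_smul_le (hs : 0 < s) {c : ℝ} (hc : 0 < c) (hc1 : c ≤ 1)
    {A : Set (EuclideanSpace ℝ (Fin N))} (hA : MeasurableSet A) :
    fracPer N s ((c • ·) ⁻¹' A) ≤ ENNReal.ofReal (c⁻¹ ^ N) * fracPer N s A := by
  refine (lintegral_lintegral_preimage_smul_le hc hA hA.compl ofReal_ne_top
    (fracKer_le_mul_smul hs hc hc1)).trans_eq ?_
  rw [pow_two, ← mul_assoc, ← ENNReal.ofReal_mul (by positivity), ← mul_pow,
    mul_inv_cancel₀ hc.ne']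
  simp [fracPer]

lemma rieszPot_preimage_smul_le {g : EuclideanSpace ℝ (Fin N) → ℝ}
    (hg : ∀ x : EuclideanSpace ℝ (Fin N), x ≠ 0 → ∀ l : ℝ, 1 ≤ l → g (l • x) ≤ g x)
    {c : ℝ} (hc : 0 < c) (hc1 : c ≤ 1)
    {A : Set (EuclideanSpace ℝ (Fin N))} (hA : MeasurableSet A) :
    rieszPot N g ((c • ·) ⁻¹' A) ≤ ENNReal.ofReal (c⁻¹ ^ N) ^ 2 * rieszPot N g A := by
  have h := lintegral_lintegral_preimage_smul_le hc hA hA one_ne_top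
    (k := fun z => ENNReal.ofReal (g z)) fun z => ?_
  · rwa [one_mul] at h
  rw [one_mul]
  refine ENNReal.ofReal_le_ofReal ?_
  rcases eq_or_ne z 0 with rfl | hz
  · simp
  · simpa [smul_smul, inv_mul_cancel₀ hc.ne'] using
      hg (c • z) (smul_ne_zero hc.ne' hz) c⁻¹ ((one_le_inv₀ hc).2 hc1)

/-- The fractional kernel integrated against the truncated distance `min ‖h‖ l`. -/
noncomputable def truncMoment (N : ℕ) (s l : ℝ) : ℝ≥0∞ :=
  ∫⁻ h : EuclideanSpace ℝ (Fin N), fracKer N s h * ENNReal.ofReal (min ‖h‖ l)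

lemma integrableOn_rpow_mul_min (hs : s ∈ Ioo (0 : ℝ) 1) :
    IntegrableOn (fun t : ℝ => t ^ (-1 - s) * min t 1) (Ioi 0) := by
  rw [← Ioc_union_Ioi_eq_Ioi zero_le_one, integrableOn_union]
  constructor
  · have h := (intervalIntegrable_iff_integrableOn_Ioc_of_le zero_le_one).1
      (intervalIntegral.intervalIntegrable_rpow' (a := 0) (b := 1) (r := -s) (by linarith [hs.2]))
    refine h.congr_fun (fun t ht => ?_) measurableSet_Ioc
    simp only
    rw [min_eq_left ht.2, ← Real.rpow_add_one ht.1.ne']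
    congr 1; ring
  · have h := integrableOn_Ioi_rpow_of_lt (a := -1 - s) (by linarith [hs.1]) zero_lt_one
    refine h.congr_fun (fun t ht => ?_) measurableSet_Ioi
    simp only
    rw [min_eq_right (le_of_lt ht), mul_one]

lemma truncMoment_one_lt_top [NeZero N] (hs : s ∈ Ioo (0 : ℝ) 1) : truncMoment N s 1 < ∞ := by
  have h : Integrable (fun x : EuclideanSpace ℝ (Fin N) =>
      ‖x‖ ^ (-((N : ℝ) + s)) * min ‖x‖ 1) := by
    rw [integrable_fun_norm_addHaar volume (f := fun t : ℝ => t ^ (-((N : ℝ) + s)) * min t 1),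
      finrank_euclideanSpace_fin]
    refine (integrableOn_rpow_mul_min hs).congr_fun (fun t ht => ?_) measurableSet_Ioi
    have ht' : 0 < t := ht
    simp only [smul_eq_mul]
    rw [← mul_assoc, ← Real.rpow_natCast, ← Real.rpow_add ht',
      Nat.cast_sub (NeZero.one_le)]
    congr 2; push_cast; ring
  refine lt_of_le_of_lt (lintegral_mono fun x => ?_) h.lintegral_lt_top
  rw [fracKer, ← ENNReal.ofReal_mul (by positivity)]

lemma truncMoment_eq {l : ℝ} (hl : 0 < l) :
    truncMoment N s l = ENNReal.ofReal (l ^ (1 - s)) * truncMoment N s 1 := by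
  have h := lintegral_comp_smul_of_pos (N := N) hl
    fun h => fracKer N s h * ENNReal.ofReal (min ‖h‖ l)
  have h' : ∀ x : EuclideanSpace ℝ (Fin N), fracKer N s (l • x) *
      ENNReal.ofReal (min ‖l • x‖ l) = ENNReal.ofReal (l ^ (1 - (N : ℝ) - s)) *
        (fracKer N s x * ENNReal.ofReal (min ‖x‖ 1)) := by
    intro x
    rw [fracKer_smul hl, norm_smul, Real.norm_of_nonneg hl.le]
    have : min (l * ‖x‖) l = l * min ‖x‖ 1 := by
      rw [mul_min_of_nonneg _ _ hl.le, mul_one]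
    rw [this, ENNReal.ofReal_mul hl.le, mul_mul_mul_comm, ← ENNReal.ofReal_mul (by positivity),
      ← Real.rpow_add_one hl.ne']
    congr 3; ring
  simp_rw [h'] at h
  rw [lintegral_const_mul' _ _ ofReal_ne_top] at h
  have h2 := congrArg (ENNReal.ofReal (l ^ N) * ·) h
  simp only [← mul_assoc] at h2
  rw [← ENNReal.ofReal_mul (by positivity), ← ENNReal.ofReal_mul (by positivity), ← mul_pow,
    mul_inv_cancel₀ hl.ne', one_pow, ENNReal.ofReal_one, one_mul, ← Real.rpow_natCast,
    ← Real.rpow_add hl] at h2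
  rw [truncMoment, ← h2, truncMoment]
  congr 3; ring

/-- Averaging over the radius the interaction of `E ∩ B_r(x)` with the complement of `B_r(x)`. -/
lemma lintegral_fracInter_ball_le (E : Set (EuclideanSpace ℝ (Fin N)))
    (x₀ : EuclideanSpace ℝ (Fin N)) (a b : ℝ) :
    ∫⁻ r in Ioo a b, fracInter N s (E ∩ ball x₀ r) (ball x₀ r)ᶜ ≤
      truncMoment N s (b - a) * volume (E ∩ ball x₀ b) := by
  set S : Set (ℝ × EuclideanSpace ℝ (Fin N) × EuclideanSpace ℝ (Fin N)) :=
    {p | dist p.2.1 x₀ < p.1 ∧ p.1 ≤ dist p.2.2 x₀} with hS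
  have hSm : MeasurableSet S :=
    (measurableSet_lt (f := fun p : ℝ × EuclideanSpace ℝ (Fin N) × EuclideanSpace ℝ (Fin N) =>
        dist p.2.1 x₀) (by fun_prop) measurable_fst).inter
      (measurableSet_le (g := fun p : ℝ × EuclideanSpace ℝ (Fin N) × EuclideanSpace ℝ (Fin N) =>
        dist p.2.2 x₀) measurable_fst (by fun_prop))
  set f : ℝ → EuclideanSpace ℝ (Fin N) → EuclideanSpace ℝ (Fin N) → ℝ≥0∞ :=
    fun r x y => S.indicator (fun p => fracKer N s (p.2.1 - p.2.2)) (r, x, y) with hf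
  have hfm : Measurable fun p : ℝ × EuclideanSpace ℝ (Fin N) × EuclideanSpace ℝ (Fin N) =>
      f p.1 p.2.1 p.2.2 :=
    ((measurable_fracKer N s).comp (by fun_prop)).indicator hSm
  have h1 : ∀ r, fracInter N s (E ∩ ball x₀ r) (ball x₀ r)ᶜ =
      ∫⁻ x in E, ∫⁻ y, f r x y := by
    intro r
    rw [fracInter, inter_comm, ← setLIntegral_indicator measurableSet_ball]
    refine lintegral_congr fun x => ?_
    by_cases hx : x ∈ ball x₀ r
    · rw [indicator_of_mem hx, ← lintegral_indicator measurableSet_ball.compl]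
      refine lintegral_congr fun y => ?_
      simp only [hf, hS, indicator, mem_compl_iff, mem_ball, mem_ofPred_eq, not_lt]
      simp only [mem_ball] at hx
      simp [hx]
    · rw [indicator_of_notMem hx]
      simp only [mem_ball] at hx
      simp [hf, hS, hx]
  have h2 : ∀ x y, ∫⁻ r in Ioo a b, f r x y ≤ (ball x₀ b).indicator
      (fun x => fracKer N s (x - y) * ENNReal.ofReal (min ‖x - y‖ (b - a))) x := by
    intro x y
    by_cases hx : x ∈ ball x₀ b
    · rw [indicator_of_mem hx]
      calc ∫⁻ r in Ioo a b, f r x y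
          ≤ ∫⁻ r in Ioo a b, (Ioc (dist x x₀) (dist y x₀)).indicator
              (fun _ => fracKer N s (x - y)) r := by
            refine lintegral_mono fun r => le_of_eq ?_
            simp only [hf, hS, indicator, mem_ofPred_eq, mem_Ioc]
        _ = fracKer N s (x - y) * volume (Ioc (dist x x₀) (dist y x₀) ∩ Ioo a b) := by
            rw [setLIntegral_indicator measurableSet_Ioc, setLIntegral_const]
        _ ≤ _ := by
            gcongr
            rw [ENNReal.ofReal_min]
            refine le_min ?_ ?_
            · refine (measure_mono inter_subset_left).trans ?_
              rw [Real.volume_Ioc]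
              refine ENNReal.ofReal_le_ofReal ?_
              rw [← dist_eq_norm]
              linarith [dist_triangle_left y x₀ x]
            · exact (measure_mono inter_subset_right).trans Real.volume_Ioo.le
    · rw [indicator_of_notMem hx, nonpos_iff_eq_zero]
      rw [mem_ball, not_lt] at hx
      rw [← lintegral_zero (μ := volume.restrict (Ioo a b))]
      refine setLIntegral_congr_fun measurableSet_Ioo fun r hr => ?_
      have : ¬ dist x x₀ < r := by linarith [hr.2]
      simp [hf, hS, this]
  calc ∫⁻ r in Ioo a b, fracInter N s (E ∩ ball x₀ r) (ball x₀ r)ᶜ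
      = ∫⁻ r in Ioo a b, ∫⁻ x in E, ∫⁻ y, f r x y := lintegral_congr h1
    _ = ∫⁻ x in E, ∫⁻ r in Ioo a b, ∫⁻ y, f r x y := by
        refine lintegral_lintegral_swap (Measurable.aemeasurable ?_)
        exact Measurable.lintegral_prod_right'
          (f := fun p : (ℝ × EuclideanSpace ℝ (Fin N)) × EuclideanSpace ℝ (Fin N) =>
            f p.1.1 p.1.2 p.2) (hfm.comp
              (f := fun p : (ℝ × EuclideanSpace ℝ (Fin N)) × EuclideanSpace ℝ (Fin N) =>
                (p.1.1, p.1.2, p.2)) (by fun_prop))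
    _ = ∫⁻ x in E, ∫⁻ y, ∫⁻ r in Ioo a b, f r x y := by
        refine lintegral_congr fun x => ?_
        refine lintegral_lintegral_swap (Measurable.aemeasurable ?_)
        exact hfm.comp (f := fun p : ℝ × EuclideanSpace ℝ (Fin N) => (p.1, x, p.2)) (by fun_prop)
    _ ≤ ∫⁻ x in E, (ball x₀ b).indicator (fun _ => truncMoment N s (b - a)) x := by
        refine lintegral_mono fun x => ?_
        by_cases hx : x ∈ ball x₀ b
        · rw [indicator_of_mem hx, truncMoment, ← lintegral_sub_left_eq_self
            (fun h => fracKer N s h * ENNReal.ofReal (min ‖h‖ (b - a))) x]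
          refine lintegral_mono fun y => (h2 x y).trans_eq ?_
          rw [indicator_of_mem hx]
        · rw [indicator_of_notMem hx,
            ← lintegral_zero (μ := (volume : Measure (EuclideanSpace ℝ (Fin N))))]
          refine lintegral_mono fun y => (h2 x y).trans_eq ?_
          rw [indicator_of_notMem hx]
    _ = truncMoment N s (b - a) * volume (E ∩ ball x₀ b) := by
        rw [setLIntegral_indicator measurableSet_ball, setLIntegral_const, inter_comm]

/-- The volume of the unit ball. -/
noncomputable def unitBallVol (N : ℕ) : ℝ :=
  volume.real (ball (0 : EuclideanSpace ℝ (Fin N)) 1)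

lemma unitBallVol_pos (N : ℕ) : 0 < unitBallVol N :=
  ENNReal.toReal_pos (measure_ball_pos _ _ one_pos).ne' measure_ball_lt_top.ne

lemma volume_ball_eq (x : EuclideanSpace ℝ (Fin N)) {r : ℝ} (hr : 0 < r) :
    volume (ball x r) = ENNReal.ofReal (unitBallVol N * r ^ N) := by
  rw [Measure.addHaar_ball_of_pos _ _ hr, finrank_euclideanSpace_fin, mul_comm (unitBallVol N),
    ENNReal.ofReal_mul (by positivity), unitBallVol, ofReal_measureReal measure_ball_lt_top.ne]

lemma ofReal_mul_volume_le_fracInter_compl (hs : 0 < s) {A : Set (EuclideanSpace ℝ (Fin N))}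
    (hA : MeasurableSet A) {R : ℝ} (hR : 0 < R)
    (hAR : volume A ≤ ENNReal.ofReal (unitBallVol N / 2 * R ^ N)) :
    ENNReal.ofReal (unitBallVol N / 2 * R ^ (-s)) * volume A ≤ fracInter N s A Aᶜ := by
  have hω := unitBallVol_pos N
  rw [← setLIntegral_const]
  refine setLIntegral_mono' hA fun x hx => ?_
  calc ENNReal.ofReal (unitBallVol N / 2 * R ^ (-s))
      = ENNReal.ofReal (R ^ (-((N : ℝ) + s))) * ENNReal.ofReal (unitBallVol N / 2 * R ^ N) := by
        rw [← ENNReal.ofReal_mul (by positivity)]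
        congr 1
        rw [mul_left_comm, ← Real.rpow_natCast, ← Real.rpow_add hR]
        congr 2; ring
    _ ≤ ENNReal.ofReal (R ^ (-((N : ℝ) + s))) * volume (ball x R \ A) := by
        gcongr
        refine le_trans ?_ le_measure_sdiff
        rw [volume_ball_eq x hR]
        refine le_trans ?_ (tsub_le_tsub_left hAR _)
        rw [← ENNReal.ofReal_sub _ (by positivity)]
        exact ENNReal.ofReal_le_ofReal (by linarith)
    _ = ∫⁻ y in ball x R \ A, ENNReal.ofReal (R ^ (-((N : ℝ) + s))) := by
        rw [setLIntegral_const]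
    _ ≤ ∫⁻ y in ball x R \ A, fracKer N s (x - y) := by
        refine setLIntegral_mono' (measurableSet_ball.diff hA) fun y hy => ?_
        refine ENNReal.ofReal_le_ofReal ?_
        have hxy : 0 < ‖x - y‖ := by
          rw [norm_pos_iff, sub_ne_zero]
          rintro rfl
          exact hy.2 hx
        refine Real.rpow_le_rpow_of_nonpos hxy ?_ (by linarith [(Nat.cast_nonneg N : (0 : ℝ) ≤ N)])
        rw [← dist_eq_norm, dist_comm]
        exact (mem_ball.1 hy.1).le
    _ ≤ ∫⁻ y in Aᶜ, fracKer N s (x - y) := lintegral_mono_set fun y hy => hy.2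

lemma exists_ball_fracPer_lt_top [NeZero N] (hs : s ∈ Ioo (0 : ℝ) 1) :
    ∃ r : ℝ, 0 < r ∧ unitBallVol N * r ^ N < 1 ∧
      fracPer N s (ball (0 : EuclideanSpace ℝ (Fin N)) r) < ∞ := by
  have hω := unitBallVol_pos N
  set b : ℝ := 1 / (1 + unitBallVol N) with hb
  have hb0 : 0 < b := by positivity
  have hb1 : b ≤ 1 := by rw [hb, div_le_one (by positivity)]; linarith
  have hbω : unitBallVol N * b < 1 := by
    rw [hb, mul_one_div, div_lt_one (by positivity)]; linarith
  suffices h : ∃ r ∈ Ioo (b / 2) b, fracPer N s (ball (0 : EuclideanSpace ℝ (Fin N)) r) < ∞ by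
    obtain ⟨r, hr, hfin⟩ := h
    have hr0 : 0 < r := by linarith [hr.1]
    refine ⟨r, hr0, lt_of_le_of_lt ?_ hbω, hfin⟩
    gcongr
    exact (pow_le_of_le_one hr0.le (hr.2.le.trans hb1) (NeZero.ne N)).trans hr.2.le
  by_contra! hcon
  have h1 := lintegral_fracInter_ball_le (s := s) univ
    (0 : EuclideanSpace ℝ (Fin N)) (b / 2) b
  have h2 : ∫⁻ r in Ioo (b / 2) b, (∞ : ℝ≥0∞) ≤
      ∫⁻ r in Ioo (b / 2) b, fracInter N s (univ ∩ ball (0 : EuclideanSpace ℝ (Fin N)) r)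
        (ball (0 : EuclideanSpace ℝ (Fin N)) r)ᶜ := by
    refine setLIntegral_mono' measurableSet_Ioo fun r hr => ?_
    rw [univ_inter]
    exact hcon r hr
  rw [setLIntegral_const, Real.volume_Ioo, ENNReal.top_mul] at h2
  · refine (h2.trans h1).not_gt (ENNReal.mul_lt_top ?_ ?_)
    · rw [truncMoment_eq (by linarith)]
      exact ENNReal.mul_lt_top ofReal_lt_top (truncMoment_one_lt_top hs)
    · rw [univ_inter]
      exact measure_ball_lt_top
  · rw [ne_eq, ENNReal.ofReal_eq_zero]
    linarith

lemma exists_energy_le [NeZero N] (hs : s ∈ Ioo (0 : ℝ) 1) {g : EuclideanSpace ℝ (Fin N) → ℝ}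
    (hgint : Integrable g volume) :
    ∃ C : ℝ, 0 ≤ C ∧ ∀ m : ℝ, 1 ≤ m → ∃ F : Set (EuclideanSpace ℝ (Fin N)), MeasurableSet F ∧
      volume F = ENNReal.ofReal m ∧
      fracPer N s F + rieszPot N g F ≤ ENNReal.ofReal C * ENNReal.ofReal m := by
  obtain ⟨r, hr, hr1, hfin⟩ := exists_ball_fracPer_lt_top (N := N) hs
  set v := unitBallVol N * r ^ N with hv
  have hv0 : 0 < v := mul_pos (unitBallVol_pos N) (by positivity)
  have hG := hgint.lintegral_lt_top
  set P := fracPer N s (ball (0 : EuclideanSpace ℝ (Fin N)) r)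
  set G := ∫⁻ z, ENNReal.ofReal (g z)
  refine ⟨P.toReal / v + G.toReal, by positivity, fun m hm => ?_⟩
  have hm0 : 0 < m := by linarith
  set c : ℝ := (v / m) ^ (1 / (N : ℝ)) with hc
  have hc0 : 0 < c := by positivity
  have hcN : c ^ N = v / m := by
    rw [hc, one_div, Real.rpow_inv_natCast_pow (by positivity) (NeZero.ne N)]
  have hc1 : c ≤ 1 := by
    refine Real.rpow_le_one (by positivity) ?_ (by positivity)
    rw [div_le_one hm0]; linarith
  have hvol : volume ((c • ·) ⁻¹' ball (0 : EuclideanSpace ℝ (Fin N)) r) = ENNReal.ofReal m := by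
    rw [volume_preimage_smul hc0 measurableSet_ball, volume_ball_eq _ hr,
      ← ENNReal.ofReal_mul (by positivity), inv_pow, hcN, ← hv]
    congr 1; field_simp
  refine ⟨_, measurableSet_ball.preimage (measurable_const_smul c), hvol, ?_⟩
  have h1 := fracPer_preimage_smul_le (N := N) hs.1 hc0 hc1
    (measurableSet_ball (x := (0 : EuclideanSpace ℝ (Fin N))) (ε := r))
  have h2 := rieszPot_le g ((c • ·) ⁻¹' ball (0 : EuclideanSpace ℝ (Fin N)) r)
  rw [hvol] at h2
  refine (add_le_add h1 h2).trans_eq ?_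
  rw [inv_pow, hcN, inv_div, ENNReal.ofReal_add (by positivity) (by positivity), add_mul,
    ENNReal.ofReal_toReal hG.ne, ← ENNReal.ofReal_mul (by positivity)]
  congr 1
  change _ * P = _
  rw [← ENNReal.ofReal_toReal hfin.ne, ← ENNReal.ofReal_mul (by positivity)]
  congr 1
  rw [ENNReal.toReal_ofReal (by positivity)]
  field_simp

/-- Removing a piece from a minimizer and dilating back to the original volume. -/
lemma fracInter_compl_le_of_minimizer [NeZero N] (hs : 0 < s)
    {g : EuclideanSpace ℝ (Fin N) → ℝ}
    (hg : ∀ x : EuclideanSpace ℝ (Fin N), x ≠ 0 → ∀ l : ℝ, 1 ≤ l → g (l • x) ≤ g x)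
    {C m : ℝ} (hm : 0 < m) {E : Set (EuclideanSpace ℝ (Fin N))} (hE : MeasurableSet E)
    (hvol : volume E = ENNReal.ofReal m)
    (hmin : ∀ F : Set (EuclideanSpace ℝ (Fin N)), MeasurableSet F →
      volume F = ENNReal.ofReal m →
        fracPer N s E + rieszPot N g E ≤ fracPer N s F + rieszPot N g F)
    (hC : fracPer N s E + rieszPot N g E ≤ ENNReal.ofReal C * ENNReal.ofReal m)
    {B : Set (EuclideanSpace ℝ (Fin N))} (hB : MeasurableSet B)
    (hEB : volume (E ∩ B) < ENNReal.ofReal m) :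
    fracInter N s (E ∩ B) Eᶜ ≤
      fracInter N s (E ∩ B) (E \ B) + 2 * ENNReal.ofReal C * volume (E ∩ B) := by
  set A := E ∩ B with hA
  set F := E \ B with hF
  have hAm : MeasurableSet A := hE.inter hB
  have hFm : MeasurableSet F := hE.diff hB
  set u := (volume A).toReal with hu
  have hAu : volume A = ENNReal.ofReal u := (ENNReal.ofReal_toReal hEB.ne_top).symm
  have hu0 : 0 ≤ u := ENNReal.toReal_nonneg
  have hum : u < m := by
    rw [hAu] at hEB
    exact (ENNReal.ofReal_lt_ofReal_iff hm).1 hEB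
  have hFvol : volume F = ENNReal.ofReal (m - u) := by
    have h : volume A + volume F = volume E := measure_inter_add_sdiff E hB
    rw [ENNReal.ofReal_sub _ hu0, ← hvol, ← hAu, ← h,
      ENNReal.add_sub_cancel_left hEB.ne_top]
  have hmu : 0 < m - u := by linarith
  set c : ℝ := ((m - u) / m) ^ (1 / (N : ℝ)) with hc
  have hc0 : 0 < c := by positivity
  have hcN : c ^ N = (m - u) / m := by
    rw [hc, one_div, Real.rpow_inv_natCast_pow (by positivity) (NeZero.ne N)]
  have hc1 : c ≤ 1 := by
    refine Real.rpow_le_one (by positivity) ?_ (by positivity)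
    rw [div_le_one hm]; linarith
  set q := ENNReal.ofReal (c⁻¹ ^ N) with hq
  have hq1 : 1 ≤ q := by
    rw [hq, ENNReal.one_le_ofReal]
    exact one_le_pow₀ ((one_le_inv₀ hc0).2 hc1)
  have hcmp := hmin ((c • ·) ⁻¹' F) (hFm.preimage (measurable_const_smul c)) (by
    rw [volume_preimage_smul hc0 hFm, hFvol, ← ENNReal.ofReal_mul (by positivity), inv_pow, hcN]
    congr 1; field_simp)
  have hcmp' : fracPer N s E + rieszPot N g E ≤ q ^ 2 * (fracPer N s F + rieszPot N g F) := by
    refine hcmp.trans ?_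
    rw [mul_add]
    refine add_le_add ((fracPer_preimage_smul_le hs hc0 hc1 hFm).trans ?_)
      (rieszPot_preimage_smul_le hg hc0 hc1 hFm)
    gcongr
    exact le_self_pow₀ hq1 two_ne_zero
  set p := ENNReal.ofReal (c ^ N) with hp
  have hpq : p * q = 1 := by
    rw [hp, hq, ← ENNReal.ofReal_mul (by positivity), ← mul_pow, mul_inv_cancel₀ hc0.ne',
      one_pow, ENNReal.ofReal_one]
  have hp2 : 1 ≤ p ^ 2 + 2 * ENNReal.ofReal (u / m) := by
    rw [hp, hcN, ← ENNReal.ofReal_pow (by positivity), ← ENNReal.ofReal_ofNat,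
      ← ENNReal.ofReal_mul (by norm_num), ← ENNReal.ofReal_add (by positivity) (by positivity),
      ENNReal.one_le_ofReal, sub_div, div_self hm.ne']
    nlinarith [sq_nonneg (u / m)]
  have hmain : fracPer N s E + rieszPot N g E ≤
      fracPer N s F + rieszPot N g F + 2 * ENNReal.ofReal C * volume A := by
    calc fracPer N s E + rieszPot N g E
        ≤ (p ^ 2 + 2 * ENNReal.ofReal (u / m)) * (fracPer N s E + rieszPot N g E) :=
          le_mul_of_one_le_left' hp2
      _ = p ^ 2 * (fracPer N s E + rieszPot N g E) +
            2 * ENNReal.ofReal (u / m) * (fracPer N s E + rieszPot N g E) := add_mul _ _ _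
      _ ≤ p ^ 2 * (q ^ 2 * (fracPer N s F + rieszPot N g F)) +
            2 * ENNReal.ofReal (u / m) * (ENNReal.ofReal C * ENNReal.ofReal m) := by
          gcongr
      _ = _ := by
          rw [← mul_assoc (p ^ 2), ← mul_pow, hpq, one_pow, one_mul, hAu]
          have : ENNReal.ofReal u = ENNReal.ofReal (u / m) * ENNReal.ofReal m := by
            rw [← ENNReal.ofReal_mul (by positivity)]
            congr 1; field_simp
          rw [this]
          ring
  have hEFA : F ∪ A = E := by rw [hF, hA, union_comm, inter_union_sdiff]
  have hdisj : Disjoint F A := disjoint_sdiff_inter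
  have hFc : Fᶜ = Eᶜ ∪ A := by
    ext x
    simp only [hF, hA, mem_compl_iff, mem_sdiff, mem_union, mem_inter_iff]
    tauto
  have hPE : fracPer N s E = fracInter N s F Eᶜ + fracInter N s A Eᶜ := by
    rw [fracPer_eq_fracInter, ← fracInter_union_left _ hAm hdisj, hEFA]
  have hPF : fracPer N s F = fracInter N s F Eᶜ + fracInter N s A F := by
    rw [fracPer_eq_fracInter, fracInter_comm A F, hFc]
    exact fracInter_union_right _ hAm (disjoint_compl_left_iff_subset.2 inter_subset_left)
  have hVF : rieszPot N g F ≤ rieszPot N g E := rieszPot_mono g sdiff_subset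
  have hEfin : fracPer N s E + rieszPot N g E ≠ ∞ :=
    ne_top_of_le_ne_top (ENNReal.mul_ne_top ofReal_ne_top ofReal_ne_top) hC
  have hfin : fracInter N s F Eᶜ + rieszPot N g E ≠ ∞ := by
    refine ne_top_of_le_ne_top hEfin ?_
    rw [hPE]
    gcongr
    exact le_self_add
  refine (ENNReal.add_le_add_iff_left hfin).1 ?_
  calc fracInter N s F Eᶜ + rieszPot N g E + fracInter N s A Eᶜ
      = fracPer N s E + rieszPot N g E := by rw [hPE]; ring
    _ ≤ _ := hmain
    _ ≤ fracPer N s F + rieszPot N g E + 2 * ENNReal.ofReal C * volume A := by gcongr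
    _ = _ := by rw [hPF]; ring

lemma ofReal_mul_volume_inter_ball_le (hs : 0 < s) {E : Set (EuclideanSpace ℝ (Fin N))}
    (hE : MeasurableSet E) {x : EuclideanSpace ℝ (Fin N)} {C R r : ℝ} (hR : 0 < R)
    (hCR : 2 * (2 * C) ≤ unitBallVol N / 4 * R ^ (-s)) (hC : 0 ≤ C)
    (hquasi : fracInter N s (E ∩ ball x r) Eᶜ ≤
      fracInter N s (E ∩ ball x r) (E \ ball x r) +
        2 * ENNReal.ofReal C * volume (E ∩ ball x r))
    (hvol : volume (E ∩ ball x r) ≤ ENNReal.ofReal (unitBallVol N / 2 * R ^ N)) :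
    ENNReal.ofReal (unitBallVol N / 4 * R ^ (-s)) * volume (E ∩ ball x r) ≤
      2 * fracInter N s (E ∩ ball x r) (ball x r)ᶜ := by
  have hω := unitBallVol_pos N
  set A := E ∩ ball x r with hA
  have hAm : MeasurableSet A := hE.inter measurableSet_ball
  have hAfin : volume A ≠ ∞ := ne_top_of_le_ne_top ofReal_ne_top hvol
  have hAc : Aᶜ = Eᶜ ∪ E \ ball x r := by
    ext y
    simp only [hA, mem_compl_iff, mem_sdiff, mem_union, mem_inter_iff]
    tauto
  have hiso := ofReal_mul_volume_le_fracInter_compl hs hAm hR hvol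
  rw [hAc, fracInter_union_right A (hE.diff measurableSet_ball)
    (disjoint_compl_left_iff_subset.2 sdiff_subset)] at hiso
  have hJ : fracInter N s A (E \ ball x r) ≤ fracInter N s A (ball x r)ᶜ :=
    fracInter_mono subset_rfl fun y hy => hy.2
  have hsplit : ENNReal.ofReal (unitBallVol N / 2 * R ^ (-s)) =
      ENNReal.ofReal (unitBallVol N / 4 * R ^ (-s)) +
        ENNReal.ofReal (unitBallVol N / 4 * R ^ (-s)) := by
    rw [← ENNReal.ofReal_add (by positivity) (by positivity)]
    congr 1; ring
  have hCR' : 2 * ENNReal.ofReal C ≤ ENNReal.ofReal (unitBallVol N / 4 * R ^ (-s)) := by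
    rw [← ENNReal.ofReal_ofNat, ← ENNReal.ofReal_mul (by norm_num)]
    exact ENNReal.ofReal_le_ofReal (by linarith)
  rw [hsplit, add_mul] at hiso
  refine (ENNReal.add_le_add_iff_left
    (ENNReal.mul_ne_top (ofReal_ne_top (r := unitBallVol N / 4 * R ^ (-s))) hAfin)).1 ?_
  calc _ ≤ _ := hiso
    _ ≤ fracInter N s A (ball x r)ᶜ + 2 * ENNReal.ofReal C * volume A +
          fracInter N s A (ball x r)ᶜ := by
        gcongr
        exact hquasi.trans (by gcongr)
    _ ≤ fracInter N s A (ball x r)ᶜ +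
          ENNReal.ofReal (unitBallVol N / 4 * R ^ (-s)) * volume A +
          fracInter N s A (ball x r)ᶜ := by gcongr
    _ = _ := by ring

lemma measureReal_inter_ball_le [NeZero N] (hs : s ∈ Ioo (0 : ℝ) 1)
    {E : Set (EuclideanSpace ℝ (Fin N))}
    (hE : MeasurableSet E) {x : EuclideanSpace ℝ (Fin N)} {C R a b : ℝ} (hR : 0 < R)
    (hCR : 2 * (2 * C) ≤ unitBallVol N / 4 * R ^ (-s)) (hC : 0 ≤ C) (hab : a < b)
    (hquasi : ∀ r ≤ b, fracInter N s (E ∩ ball x r) Eᶜ ≤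
      fracInter N s (E ∩ ball x r) (E \ ball x r) +
        2 * ENNReal.ofReal C * volume (E ∩ ball x r))
    (hvol : volume.real (E ∩ ball x b) ≤ unitBallVol N / 2 * R ^ N) :
    volume.real (E ∩ ball x a) ≤
      8 * (truncMoment N s 1).toReal / unitBallVol N * (R / (b - a)) ^ s *
        volume.real (E ∩ ball x b) := by
  have hω := unitBallVol_pos N
  have hl : 0 < b - a := by linarith
  have hfin : ∀ r, volume (E ∩ ball x r) ≠ ∞ := fun r =>
    ne_top_of_le_ne_top measure_ball_lt_top.ne (measure_mono inter_subset_right)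
  have hvol' : volume (E ∩ ball x b) ≤ ENNReal.ofReal (unitBallVol N / 2 * R ^ N) := by
    rw [← ofReal_measureReal (hfin b)]
    exact ENNReal.ofReal_le_ofReal hvol
  have h1 : ENNReal.ofReal (unitBallVol N / 4 * R ^ (-s)) * volume (E ∩ ball x a) *
      ENNReal.ofReal (b - a) ≤
        2 * (ENNReal.ofReal ((b - a) ^ (1 - s)) * truncMoment N s 1 *
          volume (E ∩ ball x b)) := by
    calc _ = ∫⁻ r in Ioo a b,
          ENNReal.ofReal (unitBallVol N / 4 * R ^ (-s)) * volume (E ∩ ball x a) := by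
          rw [setLIntegral_const, Real.volume_Ioo]
      _ ≤ ∫⁻ r in Ioo a b, 2 * fracInter N s (E ∩ ball x r) (ball x r)ᶜ := by
          refine setLIntegral_mono' measurableSet_Ioo fun r hr => ?_
          refine le_trans ?_ (ofReal_mul_volume_inter_ball_le hs.1 hE hR hCR hC
            (hquasi r hr.2.le) ((measure_mono ?_).trans hvol'))
          · have := ball_subset_ball (x := x) hr.1.le
            gcongr
          · exact inter_subset_inter_right _ (ball_subset_ball hr.2.le)
      _ ≤ _ := by
          rw [lintegral_const_mul' _ _ ofNat_ne_top, ← truncMoment_eq hl]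
          gcongr
          exact lintegral_fracInter_ball_le E x a b
  have hK := (truncMoment_one_lt_top (N := N) hs).ne
  have h2 := ENNReal.toReal_mono (ENNReal.mul_ne_top ofNat_ne_top
    (ENNReal.mul_ne_top (ENNReal.mul_ne_top ofReal_ne_top hK) (hfin b))) h1
  simp only [ENNReal.toReal_mul, ENNReal.toReal_ofNat, ← measureReal_def] at h2
  rw [ENNReal.toReal_ofReal (by positivity), ENNReal.toReal_ofReal (by positivity),
    ENNReal.toReal_ofReal (by positivity), Real.rpow_neg hR.le, Real.rpow_sub hl,
    Real.rpow_one] at h2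
  rw [Real.div_rpow hR.le hl.le]
  have hRs : 0 < R ^ s := by positivity
  have hls : 0 < (b - a) ^ s := by positivity
  set K := (truncMoment N s 1).toReal
  set U := volume.real (E ∩ ball x a)
  set V := volume.real (E ∩ ball x b)
  set l := b - a
  have h3 : U = (unitBallVol N / 4 * (R ^ s)⁻¹ * U * l) * (4 * R ^ s / (unitBallVol N * l)) := by
    field_simp
  have h4 : 8 * K / unitBallVol N * (R ^ s / l ^ s) * V =
      (2 * (l / l ^ s * K * V)) * (4 * R ^ s / (unitBallVol N * l)) := by
    field_simp; ring
  rw [h3, h4]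
  gcongr

lemma exists_rpow_le {s η : ℝ} (hs : 0 < s) (hη : 0 < η) (D : ℝ) :
    ∃ δ : ℝ, 0 < δ ∧ D * δ ^ s ≤ η := by
  refine ⟨(η / (|D| + 1)) ^ s⁻¹, by positivity, ?_⟩
  rw [Real.rpow_inv_rpow (by positivity) hs.ne']
  calc D * (η / (|D| + 1)) ≤ (|D| + 1) * (η / (|D| + 1)) := by
        gcongr
        linarith [le_abs_self D]
    _ = η := by field_simp

/-- A dyadic iteration: smallness of `U r` at scale `r` propagates to `U (r / 2) ≤ 0`. -/
lemma le_zero_of_dyadic_iteration [NeZero N] {U : ℝ → ℝ} {r δ κ D : ℝ}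
    (hmono : Monotone U) (hr : 0 < r) (hδ : 0 < δ) (hκ : 0 < κ) (hD : 0 ≤ D)
    (hDδ : D * (4 * δ) ^ s ≤ (1 / 2) ^ N)
    (hstep : ∀ R a b : ℝ, 0 < R → R ≤ δ * r → a < b → b ≤ r → U b ≤ κ * R ^ N →
      U a ≤ D * (R / (b - a)) ^ s * U b)
    (h0 : U r ≤ κ * (δ * r) ^ N) : U (r / 2) ≤ 0 := by
  have key : ∀ k : ℕ, U (r * (1 / 2 + (1 / 2) ^ (k + 1))) ≤ κ * (δ * r * (1 / 2) ^ k) ^ N := by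
    intro k
    induction k with
    | zero =>
      have : r * (1 / 2 + (1 / 2) ^ (0 + 1)) = r := by ring
      rwa [this, pow_zero, mul_one]
    | succ k ih =>
      have hk : (0 : ℝ) < (1 / 2) ^ k := by positivity
      have hk1 : ((1 : ℝ) / 2) ^ k ≤ 1 := pow_le_one₀ (by norm_num) (by norm_num)
      have hdiff : r * (1 / 2 + (1 / 2) ^ (k + 1)) - r * (1 / 2 + (1 / 2) ^ (k + 1 + 1)) =
          r * (1 / 2) ^ k / 4 := by ring
      have h := hstep (δ * r * (1 / 2) ^ k) (r * (1 / 2 + (1 / 2) ^ (k + 1 + 1)))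
        (r * (1 / 2 + (1 / 2) ^ (k + 1))) (by positivity)
        (mul_le_of_le_one_right (by positivity) hk1) (by
          have : 0 < r * (1 / 2) ^ k / 4 := by positivity
          linarith) (by
          rw [pow_succ]
          nlinarith) ih
      have hratio : δ * r * (1 / 2) ^ k / (r * (1 / 2) ^ k / 4) = 4 * δ := by
        field_simp
      rw [hdiff, hratio] at h
      calc _ ≤ D * (4 * δ) ^ s * U (r * (1 / 2 + (1 / 2) ^ (k + 1))) := h
        _ ≤ D * (4 * δ) ^ s * (κ * (δ * r * (1 / 2) ^ k) ^ N) := by gcongr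
        _ ≤ (1 / 2) ^ N * (κ * (δ * r * (1 / 2) ^ k) ^ N) := by gcongr
        _ = κ * (δ * r * (1 / 2) ^ (k + 1)) ^ N := by
          rw [mul_left_comm, ← mul_pow]
          congr 2; ring
  have hlim : Filter.Tendsto (fun k : ℕ => κ * (δ * r * (1 / 2 : ℝ) ^ k) ^ N) Filter.atTop
      (nhds (κ * (δ * r * 0) ^ N)) :=
    (((_root_.tendsto_pow_atTop_nhds_zero_of_lt_one (by norm_num) (by norm_num)).const_mul _).pow
      N).const_mul _
  rw [mul_zero, zero_pow (NeZero.ne N), mul_zero] at hlim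
  refine ge_of_tendsto' hlim fun k => (hmono ?_).trans (key k)
  have : 0 < r * (1 / 2) ^ (k + 1) := by positivity
  linarith

end

/-- Uniform density estimate: there exist `c₀, r₀ > 0` depending only on
`N, s, g` such that for every `m ≥ 1`, every minimizer `E` of `ℰ_{s,g} = P_s + V_g` with
`|E| = m`, and every point `x` with `|E ∩ B_r(x)| > 0` for all `r > 0`, one has
`|E ∩ B_r(x)| ≥ c₀ r^N` for all `r ∈ (0, r₀]`. -/
theorem uniform_density_estimate (N : ℕ) (s : ℝ) (hs : s ∈ Set.Ioo (0:ℝ) 1)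
    (g : EuclideanSpace ℝ (Fin N) → ℝ)
    (hg0 : ∀ x : EuclideanSpace ℝ (Fin N), x ≠ 0 → 0 ≤ g x)
    (hgmono : ∀ x : EuclideanSpace ℝ (Fin N), x ≠ 0 → ∀ l : ℝ, 1 ≤ l → g (l • x) ≤ g x)
    (hgsymm : ∀ x : EuclideanSpace ℝ (Fin N), x ≠ 0 → g (-x) = g x)
    (hgint : Integrable g volume) :
    ∃ c₀ : ℝ, 0 < c₀ ∧ ∃ r₀ : ℝ, 0 < r₀ ∧
      ∀ m : ℝ, 1 ≤ m →
        ∀ E : Set (EuclideanSpace ℝ (Fin N)), MeasurableSet E →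
          volume E = ENNReal.ofReal m →
          (∀ F : Set (EuclideanSpace ℝ (Fin N)), MeasurableSet F →
            volume F = ENNReal.ofReal m →
              fracPer N s E + rieszPot N g E ≤ fracPer N s F + rieszPot N g F) →
          ∀ x : EuclideanSpace ℝ (Fin N),
            (∀ r : ℝ, 0 < r → 0 < volume (E ∩ Metric.ball x r)) →
            ∀ r : ℝ, 0 < r → r ≤ r₀ →
              ENNReal.ofReal (c₀ * r ^ (N : ℕ)) ≤ volume (E ∩ Metric.ball x r) := by
  rcases Nat.eq_zero_or_pos N with rfl | hN
  · refine ⟨1, one_pos, 1, one_pos, fun m _ E _ _ _ x hx r hr _ => ?_⟩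
    have hne : (E ∩ ball x r).Nonempty := nonempty_of_measure_ne_zero (hx r hr).ne'
    rw [Subsingleton.eq_univ_of_nonempty hne, volume_euclideanSpace_eq_dirac]
    simp
  have : NeZero N := ⟨hN.ne'⟩
  have hω := unitBallVol_pos N
  obtain ⟨C, hC, hen⟩ := exists_energy_le hs hgint
  set D := 8 * (truncMoment N s 1).toReal / unitBallVol N with hD
  obtain ⟨δ', hδ', hDδ⟩ := exists_rpow_le hs.1 (by positivity : (0 : ℝ) < (1 / 2) ^ N) D
  obtain ⟨R₀, hR₀, hCR₀⟩ :=
    exists_rpow_le hs.1 (by positivity : 0 < unitBallVol N / 4) (2 * (2 * C))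
  obtain ⟨r₁, hr₁, hr₁ω, -⟩ := exists_ball_fracPer_lt_top (N := N) hs
  set δ := δ' / 4 with hδdef
  have hδ : 0 < δ := by positivity
  refine ⟨unitBallVol N / 2 * δ ^ N, by positivity, min r₁ (R₀ / δ), by positivity, ?_⟩
  intro m hm E hE hvol hmin x hx r hr hr₀
  by_contra! hcon
  have hfin : ∀ t, volume (E ∩ ball x t) ≠ ∞ := fun t =>
    ne_top_of_le_ne_top measure_ball_lt_top.ne (measure_mono inter_subset_right)
  have hquasi : ∀ t ≤ r, fracInter N s (E ∩ ball x t) Eᶜ ≤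
      fracInter N s (E ∩ ball x t) (E \ ball x t) +
        2 * ENNReal.ofReal C * volume (E ∩ ball x t) := by
    intro t ht
    obtain ⟨F, hF, hFm, hFe⟩ := hen m hm
    refine fracInter_compl_le_of_minimizer hs.1 hgmono (by linarith) hE hvol hmin
      ((hmin F hF hFm).trans hFe) measurableSet_ball ?_
    calc volume (E ∩ ball x t) ≤ volume (ball x r₁) :=
          measure_mono (inter_subset_right.trans
            (ball_subset_ball (ht.trans (hr₀.trans (min_le_left _ _)))))
      _ = ENNReal.ofReal (unitBallVol N * r₁ ^ N) := volume_ball_eq x hr₁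
      _ < ENNReal.ofReal m := (ENNReal.ofReal_lt_ofReal_iff (by linarith)).2 (by linarith)
  have hle := le_zero_of_dyadic_iteration (N := N) (U := fun t => volume.real (E ∩ ball x t))
    (r := r) (δ := δ) (κ := unitBallVol N / 2) (D := D)
    (fun t t' ht => measureReal_mono
      (inter_subset_inter_right _ (ball_subset_ball ht)) (hfin t')) hr hδ (by positivity)
    (by positivity) (by rwa [hδdef, mul_div_cancel₀ _ four_ne_zero])
    (fun R a b hR hRr hab hbr hb => measureReal_inter_ball_le hs hE hR ?_ hC hab
      (fun t ht => hquasi t (ht.trans hbr)) hb) ?_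
  · have hpos : 0 < volume.real (E ∩ ball x (r / 2)) :=
      ENNReal.toReal_pos (hx _ (by positivity)).ne' (hfin _)
    exact hle.not_gt hpos
  · have hRR₀ : R ≤ R₀ := hRr.trans (by
      rw [← le_div_iff₀' hδ]
      exact hr₀.trans (min_le_right _ _))
    rw [Real.rpow_neg hR.le, ← div_eq_mul_inv, le_div_iff₀ (Real.rpow_pos_of_pos hR s)]
    refine le_trans ?_ hCR₀
    have := hs.1
    gcongr
  · refine ENNReal.toReal_le_of_le_ofReal (by positivity) (hcon.le.trans_eq ?_)
    rw [mul_pow, mul_assoc]
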